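/- Let g be a Lorentz metric, C₁ ∈ ℝ∖{0}, C₂ ∈ ℝ, ρ ∈ ℝ, let A be a bivector, and let κ = C₁·∗_g + ρ(Ā⊗A) + C₂·Id. Then the zero set of the Fresnel polynomial of κ equals the union N(g₊) ∪ N(g₋) of the null cones of two Lorentz metrics with N(g₊) ≠ N(g₋) (κ has a double light cone) if and only if ρ ≠ 0, A ≠ 0 and det κ ≠ (C₁² + C₂²)² · (C₂ + (1/2)·tr(ρ Ā⊗A))². -/

import Mathlib

noncomputable section
open Matrix BigOperators

/-- Medium tensor components `κ^{ij}_{rs}` on ℝ⁴ (upper indices first). -/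
abbrev MT := Fin 4 → Fin 4 → Fin 4 → Fin 4 → ℝ

/-- Bivector (or 2-form) components on ℝ⁴. -/
abbrev BV := Fin 4 → Fin 4 → ℝ

/-- Totally antisymmetric Levi-Civita symbol on {0,1,2,3} with ε₀₁₂₃ = 1. -/
def eps (i j k l : Fin 4) : ℝ :=
  ((j.val : ℝ) - i.val) * ((k.val : ℝ) - i.val) * ((l.val : ℝ) - i.val) *
    ((k.val : ℝ) - j.val) * ((l.val : ℝ) - j.val) * ((l.val : ℝ) - k.val) / 12

/-- Identity medium tensor `Id^{ij}_{rs} = δ^i_r δ^j_s − δ^i_s δ^j_r`. -/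
def idT : MT := fun i j r s =>
  (if i = r then (1 : ℝ) else 0) * (if j = s then 1 else 0) -
    (if i = s then 1 else 0) * (if j = r then 1 else 0)

/-- Composition `(κ∘η)^{ij}_{rs} = (1/2) κ^{ab}_{rs} η^{ij}_{ab}`. -/
def compT (κ η : MT) : MT := fun i j r s => (1 / 2) * ∑ a, ∑ b, κ a b r s * η i j a b

/-- Poincaré adjoint `κ̄^{ij}_{rs} = (1/4) ε_{rsab} κ^{ab}_{cd} ε^{cdij}`. -/
def adjT (κ : MT) : MT := fun i j r s =>
  (1 / 4) * ∑ a, ∑ b, ∑ c, ∑ d, eps r s a b * κ a b c d * eps c d i j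

/-- Trace `tr κ = (1/2) κ^{ij}_{ij}`. -/
def traceT (κ : MT) : ℝ := (1 / 2) * ∑ i, ∑ j, κ i j i j

def antisymBV (A : BV) : Prop := ∀ i j, A i j = - A j i

def antisymMT (κ : MT) : Prop :=
  (∀ i j r s, κ i j r s = - κ j i r s) ∧ (∀ i j r s, κ i j r s = - κ i j s r)

/-- The medium tensor `(ρ Ā⊗B)^{ij}_{rs} = ρ ε_{rsab} A^{ab} B^{ij}`. -/
def tensAB (ρ : ℝ) (A B : BV) : MT := fun i j r s =>
  ρ * (∑ a, ∑ b, eps r s a b * A a b) * B i j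

/-- Hodge star `(∗_g)^{ij}_{rs} = √|det g| g^{ia} g^{jb} ε_{abrs}`. -/
def hodge (g : Matrix (Fin 4) (Fin 4) ℝ) : MT := fun i j r s =>
  Real.sqrt |g.det| * ∑ a, ∑ b, g⁻¹ i a * g⁻¹ j b * eps a b r s

/-- The (non-symmetrised) Fresnel tensor density `𝒢₀^{ijkl}`. -/
def G0 (κ : MT) (i j k l : Fin 4) : ℝ :=
  (1 / 48) * ∑ a₁, ∑ a₂, ∑ a₃, ∑ a₄, ∑ b₁, ∑ b₂, ∑ b₃, ∑ b₄, ∑ b₅, ∑ b₆,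
    κ a₁ a₂ b₁ b₂ * κ a₃ i b₃ b₄ * κ a₄ j b₅ b₆ *
      eps b₁ b₂ b₅ k * eps b₃ b₄ b₆ l * eps a₁ a₂ a₃ a₄

/-- Fresnel polynomial `G(ξ) = 𝒢₀^{ijkl} ξ_i ξ_j ξ_k ξ_l`. -/
def fresnel (κ : MT) (ξ : Fin 4 → ℝ) : ℝ :=
  ∑ i, ∑ j, ∑ k, ∑ l, G0 κ i j k l * ξ i * ξ j * ξ k * ξ l

/-- A Lorentz metric: real symmetric invertible 4×4 matrix of signature
(−+++) or (+−−−), equivalently symmetric with negative determinant. -/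
def IsLorentz (g : Matrix (Fin 4) (Fin 4) ℝ) : Prop := g.IsSymm ∧ g.det < 0

/-- Null cone `N(g) = {ξ : g^{ij} ξ_i ξ_j = 0}` (on covectors, via the inverse metric). -/
def nullCone (g : Matrix (Fin 4) (Fin 4) ℝ) : Set (Fin 4 → ℝ) :=
  {ξ | ∑ i, ∑ j, g⁻¹ i j * ξ i * ξ j = 0}

/-- The ordering O = (01, 02, 03, 23, 31, 12) of index pairs. -/
def pairs : Fin 6 → Fin 4 × Fin 4 := ![(0, 1), (0, 2), (0, 3), (2, 3), (3, 1), (1, 2)]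

/-- The 6×6 matrix representing a medium tensor: `M_{IJ} = κ^{J₁J₂}_{I₁I₂}`. -/
def mat6 (κ : MT) : Matrix (Fin 6) (Fin 6) ℝ := fun I J =>
  κ (pairs J).1 (pairs J).2 (pairs I).1 (pairs I).2

/-- The Fresnel surface decomposes into a double light cone. -/
def DoubleCone (κ : MT) : Prop :=
  ∃ gp gm, IsLorentz gp ∧ IsLorentz gm ∧ nullCone gp ≠ nullCone gm ∧
    {ξ | fresnel κ ξ = 0} = nullCone gp ∪ nullCone gm

/-- The Levi-Civita symbol with integer values. -/
def epsInt (i j k l : Fin 4) : ℤ :=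
  ((j.val : ℤ) - i.val) * ((k.val : ℤ) - i.val) * ((l.val : ℤ) - i.val) *
    ((k.val : ℤ) - j.val) * ((l.val : ℤ) - j.val) * ((l.val : ℤ) - k.val) / 12

lemma eps_eq_epsInt (i j k l : Fin 4) : eps i j k l = epsInt i j k l := by
  have h : ∀ i j k l : Fin 4, ((j.val : ℤ) - i.val) * ((k.val : ℤ) - i.val) *
      ((l.val : ℤ) - i.val) * ((k.val : ℤ) - j.val) * ((l.val : ℤ) - j.val) *
      ((l.val : ℤ) - k.val) = epsInt i j k l * 12 := by decide +kernel
  have h' := congrArg (Int.cast : ℤ → ℝ) (h i j k l)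
  push_cast at h'
  rw [eps, h', mul_div_cancel_right₀ _ (by norm_num)]

lemma eps_swap_pairs (i j k l : Fin 4) : eps k l i j = eps i j k l := by
  unfold eps; ring

lemma sum_eps_mul_eps (i j r s : Fin 4) :
    ∑ a, ∑ b, eps i j a b * eps a b r s = 2 * idT i j r s := by
  have h : ∀ i j r s : Fin 4, ∑ a, ∑ b, epsInt i j a b * epsInt a b r s =
      2 * ((if i = r then (1 : ℤ) else 0) * (if j = s then 1 else 0) -
        (if i = s then 1 else 0) * (if j = r then 1 else 0)) := by decide +kernel
  have hcast := congrArg (Int.cast : ℤ → ℝ) (h i j r s)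
  push_cast at hcast
  simpa only [eps_eq_epsInt, idT] using hcast

/-- A sum against the Levi-Civita symbol, written out over the permutations. -/
lemma sum_eps_mul (F : Fin 4 → Fin 4 → Fin 4 → Fin 4 → ℝ) :
    ∑ a, ∑ b, ∑ c, ∑ d, eps a b c d * F a b c d =
      F 0 1 2 3 - F 0 1 3 2 - F 0 2 1 3 + F 0 2 3 1 + F 0 3 1 2 - F 0 3 2 1
      - F 1 0 2 3 + F 1 0 3 2 + F 1 2 0 3 - F 1 2 3 0 - F 1 3 0 2 + F 1 3 2 0
      + F 2 0 1 3 - F 2 0 3 1 - F 2 1 0 3 + F 2 1 3 0 + F 2 3 0 1 - F 2 3 1 0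
      - F 3 0 1 2 + F 3 0 2 1 + F 3 1 0 2 - F 3 1 2 0 - F 3 2 0 1 + F 3 2 1 0 := by
  simp only [Fin.sum_univ_four, eps]
  norm_num
  ring

lemma det_eq_sum_eps (M : Matrix (Fin 4) (Fin 4) ℝ) :
    M.det = ∑ a, ∑ b, ∑ c, ∑ d, eps a b c d * (M a 0 * M b 1 * M c 2 * M d 3) := by
  rw [sum_eps_mul]
  simp [Matrix.det_succ_row_zero, Fin.sum_univ_succ, Fin.succAbove]
  ring

lemma sum_eps_mul_columns (P : Matrix (Fin 4) (Fin 4) ℝ) (e f g h : Fin 4) :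
    ∑ a, ∑ b, ∑ c, ∑ d, eps a b c d * (P a e * P b f * P c g * P d h) =
      P.det * eps e f g h := by
  have key : (P.submatrix id ![e, f, g, h]).det = P.det * eps e f g h := by
    by_cases hinj : Function.Injective ![e, f, g, h]
    · let σ : Equiv.Perm (Fin 4) := Equiv.ofBijective _ (Finite.injective_iff_bijective.1 hinj)
      have hσ : ∀ σ : Equiv.Perm (Fin 4),
          ((σ.sign : ℤˣ) : ℤ) = epsInt (σ 0) (σ 1) (σ 2) (σ 3) := by decide +kernel
      have h1 := Matrix.det_permute' σ P
      have h2 := congrArg (Int.cast : ℤ → ℝ) (hσ σ)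
      rw [← eps_eq_epsInt] at h2
      rw [h2, mul_comm] at h1
      exact h1
    · have hz : ∀ e f g h : Fin 4, ¬ Function.Injective ![e, f, g, h] →
          epsInt e f g h = 0 := by decide +kernel
      rw [eps_eq_epsInt, hz _ _ _ _ hinj]
      simp only [Function.Injective, not_forall] at hinj
      obtain ⟨i, j, hij, hne⟩ := hinj
      rw [Matrix.det_zero_of_column_eq hne (fun k => by simp [hij])]
      simp
  rw [← key, det_eq_sum_eps]
  rfl

/-- The Fresnel polynomial in terms of the contravariant tensor `Y`. -/
def fresnelForm (Y : MT) (ξ : Fin 4 → ℝ) : ℝ :=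
  ∑ a₁, ∑ a₂, ∑ a₃, ∑ a₄, eps a₁ a₂ a₃ a₄ * ∑ b₁, ∑ b₂, ∑ b₃, ∑ b₄, eps b₁ b₂ b₃ b₄ *
    ((∑ k, Y a₁ a₂ b₁ k * ξ k) * (∑ i, ∑ l, Y a₃ i b₂ l * (ξ i * ξ l)) *
      (∑ j, Y a₄ j b₃ b₄ * ξ j))

/-- The action of a matrix on contravariant tensors. -/
def pushMT (P : Matrix (Fin 4) (Fin 4) ℝ) (Y : MT) : MT := fun i j r s =>
  ∑ a, ∑ b, ∑ c, ∑ d, P i a * P j b * P r c * P s d * Y a b c d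

/-- The medium tensor obtained by lowering the last index pair of `Y`. -/
def lowerMT (Y : MT) : MT := fun i j r s => (1 / 2) * ∑ a, ∑ b, Y i j a b * eps a b r s

lemma sum_lowerMT_mul_eps {Y : MT} (hY : ∀ i j a b, Y i j b a = - Y i j a b) (i j e k : Fin 4) :
    ∑ r, ∑ s, lowerMT Y i j r s * eps r s e k = 2 * Y i j e k := by
  have h : ∑ r, ∑ s, lowerMT Y i j r s * eps r s e k =
      (1 / 2) * ∑ a, ∑ b, Y i j a b * ∑ r, ∑ s, eps a b r s * eps r s e k := by
    simp only [lowerMT, Finset.mul_sum, Finset.sum_mul, ← Fintype.sum_prod_type']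
    let φ : Fin 4 × Fin 4 × Fin 4 × Fin 4 ≃ Fin 4 × Fin 4 × Fin 4 × Fin 4 :=
      ⟨fun x => (x.2.2.1, x.2.2.2, x.1, x.2.1), fun x => (x.2.2.1, x.2.2.2, x.1, x.2.1),
        fun _ => rfl, fun _ => rfl⟩
    exact Fintype.sum_equiv φ _ _ fun x => by simp only [φ, Equiv.coe_fn_mk]; ring
  have := hY i j e k
  rw [h]
  simp only [sum_eps_mul_eps, idT, mul_sub, Finset.sum_sub_distrib, mul_ite, mul_one,
    mul_zero, Finset.sum_ite_eq', Finset.mem_univ, if_true]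
  simp [this]
  ring

lemma sum_lowerMT_mul (Y : MT) (ξ : Fin 4 → ℝ) (a e f : Fin 4) :
    ∑ j, lowerMT Y a j e f * ξ j =
      (1 / 2) * ∑ c, ∑ d, eps e f c d * ∑ j, Y a j c d * ξ j := by
  simp only [lowerMT, Finset.mul_sum, Finset.sum_mul, ← Fintype.sum_prod_type']
  let φ : Fin 4 × Fin 4 × Fin 4 ≃ Fin 4 × Fin 4 × Fin 4 :=
    ⟨fun (j, c, d) => (c, d, j), fun (c, d, j) => (j, c, d), fun _ => rfl, fun _ => rfl⟩
  refine Fintype.sum_equiv φ _ _ ?_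
  rintro ⟨j, c, d⟩
  simp only [φ, Equiv.coe_fn_mk, eps_swap_pairs c d e f]
  ring

lemma fresnel_lowerMT {Y : MT} (hY : ∀ i j a b, Y i j b a = - Y i j a b) (ξ : Fin 4 → ℝ) :
    fresnel (lowerMT Y) ξ = (1 / 24) * fresnelForm Y ξ := by
  have h : fresnel (lowerMT Y) ξ = (1 / 48) * ∑ a₁, ∑ a₂, ∑ a₃, ∑ a₄, eps a₁ a₂ a₃ a₄ *
      ∑ b₅, ∑ b₆, (∑ k, (∑ r, ∑ s, lowerMT Y a₁ a₂ r s * eps r s b₅ k) * ξ k) *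
        (∑ i, ∑ l, (∑ r, ∑ s, lowerMT Y a₃ i r s * eps r s b₆ l) * (ξ i * ξ l)) *
        ∑ j, lowerMT Y a₄ j b₅ b₆ * ξ j := by
    generalize lowerMT Y = κ
    simp only [fresnel, G0, Finset.mul_sum, Finset.sum_mul, ← Fintype.sum_prod_type']
    let φ : Fin 4 × Fin 4 × Fin 4 × Fin 4 × Fin 4 × Fin 4 × Fin 4 × Fin 4 × Fin 4 × Fin 4 ×
          Fin 4 × Fin 4 × Fin 4 × Fin 4 ≃
        Fin 4 × Fin 4 × Fin 4 × Fin 4 × Fin 4 × Fin 4 × Fin 4 ×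
          (Fin 4 × Fin 4 × Fin 4 × Fin 4) × Fin 4 × Fin 4 × Fin 4 :=
      ⟨fun (i, j, k, l, a₁, a₂, a₃, a₄, b₁, b₂, b₃, b₄, b₅, b₆) =>
          (a₁, a₂, a₃, a₄, b₅, b₆, j, (i, l, b₃, b₄), k, b₁, b₂),
        fun (a₁, a₂, a₃, a₄, b₅, b₆, j, (i, l, b₃, b₄), k, b₁, b₂) =>
          (i, j, k, l, a₁, a₂, a₃, a₄, b₁, b₂, b₃, b₄, b₅, b₆),
        fun _ => rfl, fun _ => rfl⟩
    refine Fintype.sum_equiv φ _ _ ?_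
    rintro ⟨i, j, k, l, a₁, a₂, a₃, a₄, b₁, b₂, b₃, b₄, b₅, b₆⟩
    simp only [φ, Equiv.coe_fn_mk]
    ring
  have hin : ∀ a₁ a₂ a₃ a₄ : Fin 4, ∑ b₅, ∑ b₆, (∑ k, 2 * Y a₁ a₂ b₅ k * ξ k) *
        (∑ i, ∑ l, 2 * Y a₃ i b₆ l * (ξ i * ξ l)) *
        ((1 / 2) * ∑ c, ∑ d, eps b₅ b₆ c d * ∑ j, Y a₄ j c d * ξ j) =
      2 * ∑ b₁, ∑ b₂, ∑ b₃, ∑ b₄, eps b₁ b₂ b₃ b₄ * ((∑ k, Y a₁ a₂ b₁ k * ξ k) *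
        (∑ i, ∑ l, Y a₃ i b₂ l * (ξ i * ξ l)) * (∑ j, Y a₄ j b₃ b₄ * ξ j)) := by
    intro a₁ a₂ a₃ a₄
    rw [Finset.mul_sum]
    refine Finset.sum_congr rfl fun b₅ _ => ?_
    rw [Finset.mul_sum]
    refine Finset.sum_congr rfl fun b₆ _ => ?_
    simp only [mul_assoc (2 : ℝ), ← Finset.mul_sum (a := (2 : ℝ))]
    generalize ∑ k, Y a₁ a₂ b₅ k * ξ k = L
    generalize ∑ i, ∑ l, Y a₃ i b₆ l * (ξ i * ξ l) = M
    have : ∀ c d, eps b₅ b₆ c d * (L * M * ∑ j, Y a₄ j c d * ξ j) =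
        L * M * (eps b₅ b₆ c d * ∑ j, Y a₄ j c d * ξ j) := fun c d => by ring
    simp only [this, ← Finset.mul_sum]
    ring
  rw [h]
  simp only [sum_lowerMT_mul_eps hY, sum_lowerMT_mul Y ξ, hin, fresnelForm,
    mul_left_comm (eps _ _ _ _) 2, ← Finset.mul_sum (a := (2 : ℝ))]
  ring

lemma sum_push_one (P : Matrix (Fin 4) (Fin 4) ℝ) (Y : MT) (ξ : Fin 4 → ℝ) (i j r : Fin 4) :
    ∑ s, pushMT P Y i j r s * ξ s =
      ∑ a, ∑ b, ∑ c, P i a * P j b * P r c * ∑ d, Y a b c d * (ξ ᵥ* P) d := by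
  simp only [pushMT, Matrix.vecMul, dotProduct, Finset.mul_sum, Finset.sum_mul,
    ← Fintype.sum_prod_type']
  let φ : Fin 4 × Fin 4 × Fin 4 × Fin 4 × Fin 4 ≃ Fin 4 × Fin 4 × Fin 4 × Fin 4 × Fin 4 :=
    ⟨fun (s, a, b, c, d) => (a, b, c, d, s), fun (a, b, c, d, s) => (s, a, b, c, d),
      fun _ => rfl, fun _ => rfl⟩
  refine Fintype.sum_equiv φ _ _ ?_
  rintro ⟨s, a, b, c, d⟩
  simp only [φ, Equiv.coe_fn_mk]
  ring

lemma sum_push_two (P : Matrix (Fin 4) (Fin 4) ℝ) (Y : MT) (ξ : Fin 4 → ℝ) (i r : Fin 4) :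
    ∑ j, ∑ s, pushMT P Y i j r s * (ξ j * ξ s) =
      ∑ a, ∑ c, P i a * P r c * ∑ b, ∑ d, Y a b c d * ((ξ ᵥ* P) b * (ξ ᵥ* P) d) := by
  simp only [pushMT, Matrix.vecMul, dotProduct, Finset.mul_sum, Finset.sum_mul,
    ← Fintype.sum_prod_type']
  let φ : Fin 4 × Fin 4 × Fin 4 × Fin 4 × Fin 4 × Fin 4 ≃
      Fin 4 × Fin 4 × Fin 4 × Fin 4 × Fin 4 × Fin 4 :=
    ⟨fun (j, s, a, b, c, d) => (a, c, b, d, s, j), fun (a, c, b, d, s, j) => (j, s, a, b, c, d),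
      fun _ => rfl, fun _ => rfl⟩
  refine Fintype.sum_equiv φ _ _ ?_
  rintro ⟨j, s, a, b, c, d⟩
  simp only [φ, Equiv.coe_fn_mk]
  ring

lemma sum_push_second (P : Matrix (Fin 4) (Fin 4) ℝ) (Y : MT) (ξ : Fin 4 → ℝ) (i r s : Fin 4) :
    ∑ j, pushMT P Y i j r s * ξ j =
      ∑ a, ∑ c, ∑ d, P i a * P r c * P s d * ∑ b, Y a b c d * (ξ ᵥ* P) b := by
  simp only [pushMT, Matrix.vecMul, dotProduct, Finset.mul_sum, Finset.sum_mul,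
    ← Fintype.sum_prod_type']
  let φ : Fin 4 × Fin 4 × Fin 4 × Fin 4 × Fin 4 ≃ Fin 4 × Fin 4 × Fin 4 × Fin 4 × Fin 4 :=
    ⟨fun (j, a, b, c, d) => (a, c, d, b, j), fun (a, c, d, b, j) => (j, a, b, c, d),
      fun _ => rfl, fun _ => rfl⟩
  refine Fintype.sum_equiv φ _ _ ?_
  rintro ⟨s, a, b, c, d⟩
  simp only [φ, Equiv.coe_fn_mk]
  ring

lemma sum_eps_mul_sum_columns (P : Matrix (Fin 4) (Fin 4) ℝ)
    (S : Fin 4 → Fin 4 → Fin 4 → Fin 4 → ℝ) :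
    ∑ a, ∑ b, ∑ c, ∑ d, eps a b c d *
        ∑ e, ∑ f, ∑ g, ∑ h, P a e * P b f * P c g * P d h * S e f g h =
      P.det * ∑ e, ∑ f, ∑ g, ∑ h, eps e f g h * S e f g h := by
  have : ∀ e f g h, P.det * (eps e f g h * S e f g h) =
      ∑ a, ∑ b, ∑ c, ∑ d, eps a b c d * (P a e * P b f * P c g * P d h) * S e f g h := by
    intro e f g h
    rw [← mul_assoc, ← sum_eps_mul_columns]
    simp only [Finset.sum_mul]
  simp only [Finset.mul_sum, this]
  simp only [← Fintype.sum_prod_type']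
  let φ : Fin 4 × Fin 4 × Fin 4 × Fin 4 × Fin 4 × Fin 4 × Fin 4 × Fin 4 ≃
      Fin 4 × Fin 4 × Fin 4 × Fin 4 × Fin 4 × Fin 4 × Fin 4 × Fin 4 :=
    ⟨fun (a, b, c, d, e, f, g, h) => (e, f, g, h, a, b, c, d),
      fun (e, f, g, h, a, b, c, d) => (a, b, c, d, e, f, g, h), fun _ => rfl, fun _ => rfl⟩
  refine Fintype.sum_equiv φ _ _ ?_
  rintro ⟨a, b, c, d, e, f, g, h⟩
  simp only [φ, Equiv.coe_fn_mk]
  ring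

lemma mul_sum_columns (P : Matrix (Fin 4) (Fin 4) ℝ) (L K : Fin 4 → Fin 4 → Fin 4 → ℝ)
    (M : Fin 4 → Fin 4 → ℝ) (a₁ a₂ a₃ a₄ b₁ b₂ b₃ b₄ : Fin 4) :
    (∑ e, ∑ f, ∑ g, P a₁ e * P a₂ f * P b₁ g * L e f g) * (∑ e, ∑ f, P a₃ e * P b₂ f * M e f) *
        (∑ e, ∑ f, ∑ g, P a₄ e * P b₃ f * P b₄ g * K e f g) =
      ∑ f₁, ∑ f₂, ∑ f₃, ∑ f₄, P b₁ f₁ * P b₂ f₂ * P b₃ f₃ * P b₄ f₄ *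
        ∑ e₁, ∑ e₂, ∑ e₃, ∑ e₄, P a₁ e₁ * P a₂ e₂ * P a₃ e₃ * P a₄ e₄ *
          (L e₁ e₂ f₁ * M e₃ f₂ * K e₄ f₃ f₄) := by
  simp only [Finset.mul_sum, Finset.sum_mul]
  simp only [← Fintype.sum_prod_type']
  let φ : Fin 4 × Fin 4 × Fin 4 × Fin 4 × Fin 4 × Fin 4 × Fin 4 × Fin 4 ≃
      Fin 4 × Fin 4 × Fin 4 × Fin 4 × Fin 4 × Fin 4 × Fin 4 × Fin 4 :=
    ⟨fun (e₄, f₃, f₄, e₃, f₂, e₁, e₂, f₁) => (f₁, f₂, f₃, f₄, e₁, e₂, e₃, e₄),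
      fun (f₁, f₂, f₃, f₄, e₁, e₂, e₃, e₄) => (e₄, f₃, f₄, e₃, f₂, e₁, e₂, f₁),
      fun _ => rfl, fun _ => rfl⟩
  refine Fintype.sum_equiv φ _ _ ?_
  rintro ⟨e₄, f₃, f₄, e₃, f₂, e₁, e₂, f₁⟩
  simp only [φ, Equiv.coe_fn_mk]
  ring

lemma sum_eps_sum_eps_mul_columns (P : Matrix (Fin 4) (Fin 4) ℝ)
    (T : Fin 4 → Fin 4 → Fin 4 → Fin 4 → Fin 4 → Fin 4 → Fin 4 → Fin 4 → ℝ) :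
    ∑ a₁, ∑ a₂, ∑ a₃, ∑ a₄, eps a₁ a₂ a₃ a₄ * ∑ b₁, ∑ b₂, ∑ b₃, ∑ b₄, eps b₁ b₂ b₃ b₄ *
      ∑ f₁, ∑ f₂, ∑ f₃, ∑ f₄, P b₁ f₁ * P b₂ f₂ * P b₃ f₃ * P b₄ f₄ *
        ∑ e₁, ∑ e₂, ∑ e₃, ∑ e₄, P a₁ e₁ * P a₂ e₂ * P a₃ e₃ * P a₄ e₄ *
          T e₁ e₂ e₃ e₄ f₁ f₂ f₃ f₄ =
      P.det ^ 2 * ∑ a₁, ∑ a₂, ∑ a₃, ∑ a₄, eps a₁ a₂ a₃ a₄ *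
        ∑ b₁, ∑ b₂, ∑ b₃, ∑ b₄, eps b₁ b₂ b₃ b₄ * T a₁ a₂ a₃ a₄ b₁ b₂ b₃ b₄ := by
  have hcomm : ∀ a b c d : Fin 4, P.det * ∑ f₁, ∑ f₂, ∑ f₃, ∑ f₄, eps f₁ f₂ f₃ f₄ *
        ∑ e₁, ∑ e₂, ∑ e₃, ∑ e₄, P a e₁ * P b e₂ * P c e₃ * P d e₄ *
          T e₁ e₂ e₃ e₄ f₁ f₂ f₃ f₄ =
      ∑ e₁, ∑ e₂, ∑ e₃, ∑ e₄, P a e₁ * P b e₂ * P c e₃ * P d e₄ *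
        (P.det * ∑ f₁, ∑ f₂, ∑ f₃, ∑ f₄, eps f₁ f₂ f₃ f₄ * T e₁ e₂ e₃ e₄ f₁ f₂ f₃ f₄) := by
    intro a b c d
    simp only [Finset.mul_sum]
    simp only [← Fintype.sum_prod_type']
    let φ : Fin 4 × Fin 4 × Fin 4 × Fin 4 × Fin 4 × Fin 4 × Fin 4 × Fin 4 ≃
        Fin 4 × Fin 4 × Fin 4 × Fin 4 × Fin 4 × Fin 4 × Fin 4 × Fin 4 :=
      ⟨fun (a, b, c, d, e, f, g, h) => (e, f, g, h, a, b, c, d),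
        fun (e, f, g, h, a, b, c, d) => (a, b, c, d, e, f, g, h), fun _ => rfl, fun _ => rfl⟩
    refine Fintype.sum_equiv φ _ _ ?_
    rintro ⟨e, f, g, h, e₁, e₂, e₃, e₄⟩
    simp only [φ, Equiv.coe_fn_mk]
    ring
  simp only [sum_eps_mul_sum_columns, hcomm]
  simp only [Finset.mul_sum]
  refine Finset.sum_congr rfl fun _ _ => Finset.sum_congr rfl fun _ _ =>
    Finset.sum_congr rfl fun _ _ => Finset.sum_congr rfl fun _ _ =>
    Finset.sum_congr rfl fun _ _ => Finset.sum_congr rfl fun _ _ =>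
    Finset.sum_congr rfl fun _ _ => Finset.sum_congr rfl fun _ _ => ?_
  ring

lemma fresnelForm_single (Y : MT) (hY : ∀ i j a b, Y i j b a = - Y i j a b)
    (hY' : ∀ i j a b, Y j i a b = - Y i j a b) :
    fresnelForm Y (Pi.single 0 1) =
      24 * (Matrix.of fun a b : Fin 3 => Y a.succ 0 b.succ 0).det := by
  have h1 : ∀ i j b, ∑ k, Y i j b k * (Pi.single 0 1 : Fin 4 → ℝ) k = Y i j b 0 := by
    intros; simp [Pi.single_apply]
  have h2 : ∀ i j b, ∑ k, Y i k j b * (Pi.single 0 1 : Fin 4 → ℝ) k = Y i 0 j b := by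
    intros; simp [Pi.single_apply]
  have h3 : ∀ i j, ∑ k, ∑ l, Y i k j l * ((Pi.single 0 1 : Fin 4 → ℝ) k *
      (Pi.single 0 1 : Fin 4 → ℝ) l) = Y i 0 j 0 := by
    intros; simp [Pi.single_apply]
  have z1 : ∀ a b, Y 0 0 a b = 0 := fun a b => by linarith [hY' 0 0 a b]
  have z2 : ∀ a b, Y a b 0 0 = 0 := fun a b => by linarith [hY a b 0 0]
  simp only [fresnelForm, h1, h2, h3]
  have h4 : ∀ a₁ a₂ a₃ a₄, ∑ b₁, ∑ b₂, ∑ b₃, ∑ b₄, eps b₁ b₂ b₃ b₄ *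
      (Y a₁ a₂ b₁ 0 * Y a₃ 0 b₂ 0 * Y a₄ 0 b₃ b₄) = -2 * (
      Y a₁ a₂ 1 0 * (Y a₃ 0 2 0 * Y a₄ 0 3 0 - Y a₃ 0 3 0 * Y a₄ 0 2 0) +
      Y a₁ a₂ 2 0 * (Y a₃ 0 3 0 * Y a₄ 0 1 0 - Y a₃ 0 1 0 * Y a₄ 0 3 0) +
      Y a₁ a₂ 3 0 * (Y a₃ 0 1 0 * Y a₄ 0 2 0 - Y a₃ 0 2 0 * Y a₄ 0 1 0)) := by
    intro a₁ a₂ a₃ a₄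
    rw [sum_eps_mul]
    simp only [z2, hY a₄ 0 1 0, hY a₄ 0 2 0, hY a₄ 0 3 0]
    ring
  simp only [h4]
  rw [sum_eps_mul]
  have s : ((0 : Fin 3).succ : Fin 4) = 1 ∧ (1 : Fin 3).succ = (2 : Fin 4) ∧
      (2 : Fin 3).succ = (3 : Fin 4) := ⟨rfl, rfl, rfl⟩
  simp only [z1, hY' 1 0, hY' 2 0, hY' 3 0, Matrix.det_fin_three, Matrix.of_apply, s]
  ring

lemma fresnelForm_pushMT (P : Matrix (Fin 4) (Fin 4) ℝ) (Y : MT) (ξ : Fin 4 → ℝ) :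
    fresnelForm (pushMT P Y) ξ = P.det ^ 2 * fresnelForm Y (ξ ᵥ* P) := by
  have h : fresnelForm (pushMT P Y) ξ = ∑ a₁, ∑ a₂, ∑ a₃, ∑ a₄, eps a₁ a₂ a₃ a₄ *
      ∑ b₁, ∑ b₂, ∑ b₃, ∑ b₄, eps b₁ b₂ b₃ b₄ *
        ((∑ a, ∑ b, ∑ c, P a₁ a * P a₂ b * P b₁ c * ∑ k, Y a b c k * (ξ ᵥ* P) k) *
          (∑ a, ∑ c, P a₃ a * P b₂ c *
            ∑ i, ∑ l, Y a i c l * ((ξ ᵥ* P) i * (ξ ᵥ* P) l)) *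
          (∑ a, ∑ c, ∑ d, P a₄ a * P b₃ c * P b₄ d * ∑ j, Y a j c d * (ξ ᵥ* P) j)) := by
    unfold fresnelForm
    refine Finset.sum_congr rfl fun a₁ _ => Finset.sum_congr rfl fun a₂ _ =>
      Finset.sum_congr rfl fun a₃ _ => Finset.sum_congr rfl fun a₄ _ => ?_
    congr 1
    refine Finset.sum_congr rfl fun b₁ _ => Finset.sum_congr rfl fun b₂ _ =>
      Finset.sum_congr rfl fun b₃ _ => Finset.sum_congr rfl fun b₄ _ => ?_
    rw [sum_push_one P Y ξ a₁ a₂ b₁, sum_push_two P Y ξ a₃ b₂, sum_push_second P Y ξ a₄ b₃ b₄]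
  rw [h]
  generalize ξ ᵥ* P = ζ
  rw [fresnelForm, ← sum_eps_sum_eps_mul_columns P fun e₁ e₂ e₃ e₄ f₁ f₂ f₃ f₄ =>
    (∑ k, Y e₁ e₂ f₁ k * ζ k) * (∑ i, ∑ l, Y e₃ i f₂ l * (ζ i * ζ l)) * ∑ k, Y e₄ k f₃ f₄ * ζ k]
  refine Finset.sum_congr rfl fun a₁ _ => Finset.sum_congr rfl fun a₂ _ =>
    Finset.sum_congr rfl fun a₃ _ => Finset.sum_congr rfl fun a₄ _ => ?_
  congr 1
  refine Finset.sum_congr rfl fun b₁ _ => Finset.sum_congr rfl fun b₂ _ =>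
    Finset.sum_congr rfl fun b₃ _ => Finset.sum_congr rfl fun b₄ _ => ?_
  rw [mul_sum_columns P (fun a b c => ∑ k, Y a b c k * ζ k)
    (fun a b c => ∑ k, Y a k b c * ζ k) (fun a c => ∑ i, ∑ l, Y a i c l * (ζ i * ζ l))]

/-- The contravariant form of a generalized Q-medium. -/
def qMedium (c r t : ℝ) (q A : Matrix (Fin 4) (Fin 4) ℝ) : MT := fun i j a b =>
  c * (q i a * q j b - q i b * q j a) + r * (A i j * A a b) + t * eps i j a b

/-- The second quadratic factor of the Fresnel polynomial of `qMedium`. -/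
def secondFactor (c r : ℝ) (q A : Matrix (Fin 4) (Fin 4) ℝ) : Matrix (Fin 4) (Fin 4) ℝ :=
  (c * q.det) • q + r • (Aᵀ * q.adjugate * A)

lemma qMedium_swap_right (c r t : ℝ) (q : Matrix (Fin 4) (Fin 4) ℝ) {A : Matrix (Fin 4) (Fin 4) ℝ}
    (hA : antisymBV A) (i j a b : Fin 4) :
    qMedium c r t q A i j b a = - qMedium c r t q A i j a b := by
  have h : eps i j b a = - eps i j a b := by unfold eps; ring
  simp only [qMedium, h, hA b a]
  ring

lemma qMedium_swap_left (c r t : ℝ) (q : Matrix (Fin 4) (Fin 4) ℝ) {A : Matrix (Fin 4) (Fin 4) ℝ}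
    (hA : antisymBV A) (i j a b : Fin 4) :
    qMedium c r t q A j i a b = - qMedium c r t q A i j a b := by
  have h : eps j i a b = - eps i j a b := by unfold eps; ring
  simp only [qMedium, h, hA j i]
  ring

lemma fresnelForm_qMedium_single (c r t : ℝ) {q A : Matrix (Fin 4) (Fin 4) ℝ} (hq : q.IsSymm)
    (hA : antisymBV A) :
    fresnelForm (qMedium c r t q A) (Pi.single 0 1) =
      24 * c ^ 2 * q 0 0 * secondFactor c r q A 0 0 := by
  have hA' : ∀ i, A i i = 0 := fun i => by linarith [hA i i]
  rw [fresnelForm_single]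
  · have e1 := hq.apply 0 1
    have e2 := hq.apply 0 2
    have e3 := hq.apply 0 3
    have e4 := hq.apply 1 2
    have e5 := hq.apply 1 3
    have e6 := hq.apply 2 3
    have s : ((0 : Fin 3).succ : Fin 4) = 1 ∧ (1 : Fin 3).succ = (2 : Fin 4) ∧
      (2 : Fin 3).succ = (3 : Fin 4) := ⟨rfl, rfl, rfl⟩
    have hz : ∀ i j, eps i 0 j 0 = 0 := fun i j => by simp [eps]
    have hd := Matrix.det_succ_row_zero q
    simp only [Matrix.det_fin_three, Matrix.of_apply, s, qMedium, hz, secondFactor,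
      Matrix.add_apply, Matrix.smul_apply, smul_eq_mul, Matrix.mul_apply, Matrix.transpose_apply,
      Fin.sum_univ_four, hA']
    rw [hd]
    simp only [Matrix.adjugate_fin_succ_eq_det_submatrix, Fin.sum_univ_four,
      Matrix.det_fin_three, Matrix.submatrix_apply]
    simp [Fin.succAbove, e1, e2, e3, e4, e5, e6]
    ring
  · exact qMedium_swap_right c r t q hA
  · exact qMedium_swap_left c r t q hA

lemma pushMT_qMedium (P : Matrix (Fin 4) (Fin 4) ℝ) (c r t : ℝ) (q A : Matrix (Fin 4) (Fin 4) ℝ) :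
    pushMT P (qMedium c r t q A) = qMedium c r (P.det * t) (P * q * Pᵀ) (P * A * Pᵀ) := by
  have h1 : ∀ (X : Matrix (Fin 4) (Fin 4) ℝ) i j,
      (P * X * Pᵀ) i j = ∑ a, ∑ b, P i a * P j b * X a b := by
    intro X i j
    simp only [Matrix.mul_apply, Matrix.transpose_apply, Finset.sum_mul]
    rw [Finset.sum_comm]
    exact Finset.sum_congr rfl fun a _ => Finset.sum_congr rfl fun b _ => by ring
  have h2 : ∀ i j r s, P.det * eps i j r s =
      ∑ a, ∑ b, ∑ c, ∑ d, P i a * P j b * P r c * P s d * eps a b c d := by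
    intro i j r s
    rw [← Matrix.det_transpose, ← sum_eps_mul_columns]
    simp only [Matrix.transpose_apply]
    exact Finset.sum_congr rfl fun a _ => Finset.sum_congr rfl fun b _ =>
      Finset.sum_congr rfl fun c _ => Finset.sum_congr rfl fun d _ => by ring
  have h3 : ∀ (X Z : Matrix (Fin 4) (Fin 4) ℝ) i j r s, (P * X * Pᵀ) i j * (P * Z * Pᵀ) r s =
      ∑ a, ∑ b, ∑ c, ∑ d, P i a * P j b * P r c * P s d * (X a b * Z c d) := by
    intro X Z i j r s
    simp only [h1, Finset.sum_mul]
    simp only [Finset.mul_sum]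
    exact Finset.sum_congr rfl fun a _ => Finset.sum_congr rfl fun b _ =>
      Finset.sum_congr rfl fun c _ => Finset.sum_congr rfl fun d _ => by ring
  have h4 : ∀ (X : Matrix (Fin 4) (Fin 4) ℝ) i j r s, (P * X * Pᵀ) i r * (P * X * Pᵀ) j s =
      ∑ a, ∑ b, ∑ c, ∑ d, P i a * P j b * P r c * P s d * (X a c * X b d) := by
    intro X i j r s
    rw [h3]
    refine Finset.sum_congr rfl fun a _ => ?_
    rw [Finset.sum_comm]
    exact Finset.sum_congr rfl fun b _ =>
      Finset.sum_congr rfl fun c _ => Finset.sum_congr rfl fun d _ => by ring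
  have h5 : ∀ (X : Matrix (Fin 4) (Fin 4) ℝ) i j r s, (P * X * Pᵀ) i s * (P * X * Pᵀ) j r =
      ∑ a, ∑ b, ∑ c, ∑ d, P i a * P j b * P r c * P s d * (X a d * X b c) := by
    intro X i j r s
    rw [h4]
    refine Finset.sum_congr rfl fun a _ => Finset.sum_congr rfl fun b _ => ?_
    rw [Finset.sum_comm]
    exact Finset.sum_congr rfl fun c _ => Finset.sum_congr rfl fun d _ => by ring
  funext i j k l
  have h6 : qMedium c r (P.det * t) (P * q * Pᵀ) (P * A * Pᵀ) i j k l =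
      c * ((P * q * Pᵀ) i k * (P * q * Pᵀ) j l - (P * q * Pᵀ) i l * (P * q * Pᵀ) j k) +
      r * ((P * A * Pᵀ) i j * (P * A * Pᵀ) k l) + t * (P.det * eps i j k l) := by
    unfold qMedium; ring
  rw [h6, h2, h4 q i j k l, h5 q i j k l, h3 A A i j k l]
  simp only [pushMT, qMedium, Finset.mul_sum, ← Finset.sum_add_distrib, ← Finset.sum_sub_distrib]
  exact Finset.sum_congr rfl fun a _ => Finset.sum_congr rfl fun b _ =>
      Finset.sum_congr rfl fun c _ => Finset.sum_congr rfl fun d _ => by ring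

lemma secondFactor_conj (P : Matrix (Fin 4) (Fin 4) ℝ) (c r : ℝ)
    (q A : Matrix (Fin 4) (Fin 4) ℝ) :
    secondFactor c r (P * q * Pᵀ) (P * A * Pᵀ) = P.det ^ 2 • (P * secondFactor c r q A * Pᵀ) := by
  have h : (P * A * Pᵀ)ᵀ * (P * q * Pᵀ).adjugate * (P * A * Pᵀ) =
      P.det ^ 2 • (P * (Aᵀ * q.adjugate * A) * Pᵀ) := by
    have h1 : (P * A * Pᵀ)ᵀ * (P * q * Pᵀ).adjugate * (P * A * Pᵀ) =
        P * Aᵀ * (Pᵀ * Pᵀ.adjugate) * q.adjugate * (P.adjugate * P) * A * Pᵀ := by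
      simp only [Matrix.transpose_mul, Matrix.transpose_transpose, Matrix.adjugate_mul_distrib,
        Matrix.mul_assoc]
    rw [h1, Matrix.mul_adjugate, Matrix.adjugate_mul, Matrix.det_transpose]
    simp only [Matrix.mul_smul, Matrix.smul_mul, Matrix.mul_one, smul_smul, Matrix.mul_assoc,
      pow_two]
  rw [secondFactor, h, Matrix.det_mul, Matrix.det_mul, Matrix.det_transpose, secondFactor]
  simp only [Matrix.mul_add, Matrix.add_mul, Matrix.mul_smul, Matrix.smul_mul, smul_add, smul_smul]
  congr 2 <;> ring

lemma exists_row_zero_eq {ξ : Fin 4 → ℝ} (hξ : ξ ≠ 0) :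
    ∃ C : Matrix (Fin 4) (Fin 4) ℝ, C.det ≠ 0 ∧ C 0 = ξ := by
  obtain ⟨i, hi⟩ := Function.ne_iff.1 hξ
  refine ⟨((1 : Matrix (Fin 4) (Fin 4) ℝ).updateRow i ξ).submatrix (Equiv.swap 0 i) id, ?_, ?_⟩
  · rw [Matrix.det_permute, ← Matrix.det_transpose (Matrix.updateRow _ _ _),
      ← Matrix.updateCol_transpose,
      Matrix.transpose_one, ← Matrix.cramer_apply, Matrix.cramer_one]
    simpa using hi
  · funext j
    simp

lemma fresnelForm_qMedium (c r t : ℝ) {q A : Matrix (Fin 4) (Fin 4) ℝ} (hq : q.IsSymm)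
    (hA : antisymBV A) (ξ : Fin 4 → ℝ) :
    fresnelForm (qMedium c r t q A) ξ =
      24 * c ^ 2 * (ξ ⬝ᵥ q *ᵥ ξ) * (ξ ⬝ᵥ secondFactor c r q A *ᵥ ξ) := by
  rcases eq_or_ne ξ 0 with rfl | hξ
  · simp [fresnelForm]
  obtain ⟨C, hC, rfl⟩ := exists_row_zero_eq hξ
  have h0 : ∀ X : Matrix (Fin 4) (Fin 4) ℝ, (C * X * Cᵀ) 0 0 = C 0 ⬝ᵥ X *ᵥ C 0 := by
    intro X
    rw [Matrix.mul_assoc, Matrix.mul_apply]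
    rfl
  have hq' : (C * q * Cᵀ).IsSymm := by
    simp [Matrix.IsSymm, Matrix.transpose_mul, hq.eq, Matrix.mul_assoc]
  have hA' : antisymBV (C * A * Cᵀ) := by
    have hAt : Aᵀ = -A := by ext i j; simp [hA j i]
    have h : (C * A * Cᵀ)ᵀ = -(C * A * Cᵀ) := by
      simp [Matrix.transpose_mul, hAt, Matrix.mul_assoc]
    intro i j
    simpa using congrFun (congrFun h j) i
  have h := fresnelForm_pushMT C (qMedium c r t q A) (Pi.single 0 1)
  rw [pushMT_qMedium, fresnelForm_qMedium_single _ _ _ hq' hA', secondFactor_conj,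
    Matrix.smul_apply, smul_eq_mul, h0, h0, Matrix.single_one_vecMul] at h
  refine mul_left_cancel₀ (pow_ne_zero 2 hC) (h.symm.trans ?_)
  ring

lemma lowerMT_qMedium (g A : Matrix (Fin 4) (Fin 4) ℝ) (C₁ C₂ ρ : ℝ) :
    lowerMT (qMedium (C₁ * √|g.det|) (2 * ρ) C₂ g⁻¹ A) = fun i j r s =>
      C₁ * hodge g i j r s + tensAB ρ A A i j r s + C₂ * idT i j r s := by
  funext i j r s
  have h1 : ∑ a, ∑ b, g⁻¹ i b * g⁻¹ j a * eps a b r s =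
      - ∑ a, ∑ b, g⁻¹ i a * g⁻¹ j b * eps a b r s := by
    rw [Finset.sum_comm]
    simp only [← Finset.sum_neg_distrib]
    refine Finset.sum_congr rfl fun a _ => Finset.sum_congr rfl fun b _ => ?_
    have h : eps b a r s = - eps a b r s := by unfold eps; ring
    rw [h]
    ring
  have h2 : (∑ a, ∑ b, eps r s a b * A a b) = ∑ a, ∑ b, A a b * eps a b r s :=
    Finset.sum_congr rfl fun a _ => Finset.sum_congr rfl fun b _ => by
      rw [eps_swap_pairs r s a b, mul_comm]
  have h3 : idT i j r s = (1 / 2) * ∑ a, ∑ b, eps i j a b * eps a b r s := by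
    rw [sum_eps_mul_eps]; ring
  have h4 : ∀ a b, qMedium (C₁ * √|g.det|) (2 * ρ) C₂ g⁻¹ A i j a b * eps a b r s =
      C₁ * √|g.det| * (g⁻¹ i a * g⁻¹ j b * eps a b r s) -
      C₁ * √|g.det| * (g⁻¹ i b * g⁻¹ j a * eps a b r s) +
      2 * ρ * A i j * (A a b * eps a b r s) + C₂ * (eps i j a b * eps a b r s) := by
    intro a b
    unfold qMedium
    ring
  simp only [lowerMT, hodge, tensAB, h4, h2, h3, Finset.sum_add_distrib, Finset.sum_sub_distrib,
    ← Finset.mul_sum, h1]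
  ring

/-- The Minkowski matrix. -/
def minkowski : Matrix (Fin 4) (Fin 4) ℝ := Matrix.diagonal ![-1, 1, 1, 1]

lemma exists_neg_of_prod_neg {v : Fin 4 → ℝ} (h : ∏ i, v i < 0) :
    ∃ σ : ℝ, σ ^ 2 = 1 ∧ ∃ i, σ * v i < 0 ∧ ∀ j, j ≠ i → 0 < σ * v j := by
  have key : ∀ σ : ℝ, σ ^ 2 = 1 → ∀ i, σ * v i < 0 → (∀ j, j ≠ i → 0 < σ * v j) →
      ∃ σ : ℝ, σ ^ 2 = 1 ∧ ∃ i, σ * v i < 0 ∧ ∀ j, j ≠ i → 0 < σ * v j :=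
    fun σ hσ i hi hj => ⟨σ, hσ, i, hi, hj⟩
  rw [Fin.prod_univ_four, mul_assoc, mul_neg_iff, mul_pos_iff, mul_neg_iff, mul_pos_iff,
    mul_neg_iff] at h
  rcases h with ⟨⟨h0, h1⟩ | ⟨h0, h1⟩, ⟨h2, h3⟩ | ⟨h2, h3⟩⟩ |
    ⟨⟨h0, h1⟩ | ⟨h0, h1⟩, ⟨h2, h3⟩ | ⟨h2, h3⟩⟩
  · refine key 1 (by norm_num) 3 ?_ ?_ <;> simp [Fin.forall_fin_succ, *]
  · refine key 1 (by norm_num) 2 ?_ ?_ <;> simp [Fin.forall_fin_succ, *]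
  · refine key (-1) (by norm_num) 2 ?_ ?_ <;> simp [Fin.forall_fin_succ, *]
  · refine key (-1) (by norm_num) 3 ?_ ?_ <;> simp [Fin.forall_fin_succ, *]
  · refine key 1 (by norm_num) 1 ?_ ?_ <;> simp [Fin.forall_fin_succ, *]
  · refine key (-1) (by norm_num) 0 ?_ ?_ <;> simp [Fin.forall_fin_succ, *]
  · refine key 1 (by norm_num) 0 ?_ ?_ <;> simp [Fin.forall_fin_succ, *]
  · refine key (-1) (by norm_num) 1 ?_ ?_ <;> simp [Fin.forall_fin_succ, *]

/-- The Sylvester law for Lorentz metrics. -/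
lemma exists_frame {g : Matrix (Fin 4) (Fin 4) ℝ} (hg : IsLorentz g) :
    ∃ (σ : ℝ) (P : Matrix (Fin 4) (Fin 4) ℝ), σ ^ 2 = 1 ∧ P.det ≠ 0 ∧
      g⁻¹ = σ • (P * minkowski * Pᵀ) := by
  have hq : (g⁻¹).IsHermitian := by
    rw [Matrix.IsHermitian, Matrix.conjTranspose_eq_transpose_of_trivial,
      Matrix.transpose_nonsing_inv, hg.1.eq]
  have hdet : (g⁻¹).det < 0 := by
    rw [Matrix.det_nonsing_inv, Ring.inverse_eq_inv']
    exact inv_lt_zero.2 hg.2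
  have hprod : ∏ i, hq.eigenvalues i < 0 := by
    have := hq.det_eq_prod_eigenvalues
    simpa [this] using hdet
  obtain ⟨σ, hσ, i, hi, hj⟩ := exists_neg_of_prod_neg hprod
  let τ := Equiv.swap 0 i
  let U : Matrix (Fin 4) (Fin 4) ℝ := hq.eigenvectorUnitary
  have hs : g⁻¹ = U * Matrix.diagonal hq.eigenvalues * Uᵀ := by
    have h := hq.spectral_theorem
    simpa [Unitary.conjStarAlgAut_apply, Matrix.star_eq_conjTranspose, U] using h
  have hP : g⁻¹ = σ • ((U * Matrix.diagonal (fun k => √|hq.eigenvalues k|)).submatrix id τ *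
      minkowski * ((U * Matrix.diagonal (fun k => √|hq.eigenvalues k|)).submatrix id τ)ᵀ) := by
    have h1 : minkowski = (Matrix.diagonal (minkowski.diag ∘ τ.symm)).submatrix τ τ := by
      rw [Matrix.submatrix_diagonal_equiv]
      simp [minkowski, Function.comp_assoc]
    have h2 : ∀ k, hq.eigenvalues k =
        √|hq.eigenvalues k| * (σ * minkowski.diag (τ.symm k)) * √|hq.eigenvalues k| := by
      intro k
      have h3 : |hq.eigenvalues k| = |σ * hq.eigenvalues k| := by
        rw [abs_mul, (sq_eq_sq₀ (abs_nonneg σ) zero_le_one).1 (by rw [sq_abs, hσ, one_pow]),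
          one_mul]
      have h4 : √|hq.eigenvalues k| * (σ * minkowski.diag (τ.symm k)) * √|hq.eigenvalues k| =
          σ * minkowski.diag (τ.symm k) * |σ * hq.eigenvalues k| := by
        rw [← h3, mul_comm, ← mul_assoc, Real.mul_self_sqrt (abs_nonneg _), mul_comm]
      rw [h4]
      rcases eq_or_ne k i with rfl | hk
      · have : minkowski.diag (τ.symm k) = -1 := by simp [τ, minkowski]
        rw [this, abs_of_neg hi]
        linear_combination - hq.eigenvalues k * hσ
      · have : minkowski.diag (τ.symm k) = 1 := by
          have h5 : τ.symm k ≠ 0 := by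
            intro h
            rw [Equiv.symm_apply_eq] at h
            exact hk (by simpa [τ] using h)
          obtain ⟨l, hl⟩ := Fin.exists_succ_eq.2 h5
          rw [← hl]
          fin_cases l <;> simp [minkowski]
        rw [this, abs_of_pos (hj k hk)]
        linear_combination - hq.eigenvalues k * hσ
    rw [h1, Matrix.transpose_submatrix, Matrix.submatrix_mul_equiv, Matrix.submatrix_mul_equiv]
    conv_lhs => rw [hs]
    have h3 : Matrix.diagonal hq.eigenvalues = Matrix.diagonal (fun k => √|hq.eigenvalues k|) *
        (σ • Matrix.diagonal (minkowski.diag ∘ τ.symm)) *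
        Matrix.diagonal (fun k => √|hq.eigenvalues k|) := by
      rw [← Matrix.diagonal_smul, Matrix.diagonal_mul_diagonal, Matrix.diagonal_mul_diagonal]
      exact congrArg Matrix.diagonal (funext h2)
    rw [Matrix.submatrix_id_id, Matrix.transpose_mul, Matrix.diagonal_transpose, h3]
    simp only [Matrix.mul_assoc, Matrix.smul_mul, Matrix.mul_smul]
  refine ⟨σ, _, hσ, ?_, hP⟩
  intro h0
  rw [hP] at hdet
  simp [h0] at hdet

/-- The matrix of a contravariant tensor in the ordered index pairs. -/
def bivMat (Y : MT) : Matrix (Fin 6) (Fin 6) ℝ := fun I J =>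
  Y (pairs I).1 (pairs I).2 (pairs J).1 (pairs J).2

/-- The second compound matrix. -/
def compound (P : Matrix (Fin 4) (Fin 4) ℝ) : Matrix (Fin 6) (Fin 6) ℝ := fun I J =>
  P (pairs I).1 (pairs J).1 * P (pairs I).2 (pairs J).2 -
    P (pairs I).1 (pairs J).2 * P (pairs I).2 (pairs J).1

lemma sum_mul_antisymm (G : Fin 4 → Fin 4 → ℝ) {F : Fin 4 → Fin 4 → ℝ} (hF : antisymBV F) :
    ∑ a, ∑ b, G a b * F a b =
      ∑ K, (G (pairs K).1 (pairs K).2 - G (pairs K).2 (pairs K).1) *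
        F (pairs K).1 (pairs K).2 := by
  have hd : ∀ i, F i i = 0 := fun i => by linarith [hF i i]
  simp only [Fin.sum_univ_four, Fin.sum_univ_six, pairs, Matrix.cons_val, hd, hF 1 0, hF 2 0,
    hF 3 0, hF 2 1, hF 3 2, hF 1 3]
  ring

lemma eps_swap_left (i j k l : Fin 4) : eps j i k l = - eps i j k l := by
  unfold eps; ring

lemma eps_swap_right (i j k l : Fin 4) : eps i j l k = - eps i j k l := by
  unfold eps; ring

lemma mat6_lowerMT {Y : MT} (hY : ∀ i j a b, Y i j a b = - Y i j b a) :
    mat6 (lowerMT Y) = (bivMat Y * bivMat eps)ᵀ := by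
  ext I J
  have h : ∀ a b, Y (pairs J).1 (pairs J).2 a b * eps a b (pairs I).1 (pairs I).2 =
      eps a b (pairs I).1 (pairs I).2 * Y (pairs J).1 (pairs J).2 a b := fun a b => mul_comm _ _
  simp only [mat6, lowerMT, Matrix.transpose_apply, Matrix.mul_apply, bivMat, h]
  rw [sum_mul_antisymm _ (hY (pairs J).1 (pairs J).2), Finset.mul_sum]
  refine Finset.sum_congr rfl fun K _ => ?_
  rw [eps_swap_left (pairs K).1 (pairs K).2]
  ring

lemma bivMat_pushMT (P : Matrix (Fin 4) (Fin 4) ℝ) {Y : MT}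
    (hY : ∀ i j a b, Y i j a b = - Y i j b a) (hY' : ∀ i j a b, Y i j a b = - Y j i a b) :
    bivMat (pushMT P Y) = compound P * bivMat Y * (compound P)ᵀ := by
  ext I J
  have h1 : ∀ a b, ∑ c, ∑ d, P (pairs I).1 a * P (pairs I).2 b * P (pairs J).1 c *
        P (pairs J).2 d * Y a b c d =
      ∑ L, P (pairs I).1 a * P (pairs I).2 b *
        (Y a b (pairs L).1 (pairs L).2 * compound P J L) := by
    intro a b
    rw [sum_mul_antisymm _ (hY a b)]
    exact Finset.sum_congr rfl fun L _ => by unfold compound; ring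
  simp only [bivMat, pushMT, h1, Matrix.mul_apply, Matrix.transpose_apply]
  simp only [← Finset.mul_sum]
  rw [sum_mul_antisymm]
  · simp only [Finset.mul_sum, Finset.sum_mul]
    rw [Finset.sum_comm]
    exact Finset.sum_congr rfl fun L _ => Finset.sum_congr rfl fun K _ => by
      unfold compound; ring
  · intro a b
    rw [← Finset.sum_neg_distrib]
    exact Finset.sum_congr rfl fun L _ => by rw [hY' a b]; ring

lemma det_bivMat_eps : (bivMat eps).det = -1 := by
  have : bivMat eps = !![0,0,0,1,0,0; 0,0,0,0,1,0; 0,0,0,0,0,1; 1,0,0,0,0,0; 0,1,0,0,0,0;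
      0,0,1,0,0,0] := by
    ext I J
    fin_cases I <;> fin_cases J <;> norm_num [bivMat, pairs, eps]
  rw [this]
  simp [Matrix.det_succ_row_zero, Fin.sum_univ_succ, Fin.succAbove]
  norm_num

lemma det_compound_sq (P : Matrix (Fin 4) (Fin 4) ℝ) : (compound P).det ^ 2 = P.det ^ 6 := by
  have h0 : qMedium 0 0 1 0 0 = eps := by funext i j a b; simp [qMedium]
  have h1 : pushMT P eps = P.det • eps := by
    rw [← h0, pushMT_qMedium]
    funext i j a b
    simp [qMedium]
  have h2 := bivMat_pushMT P (Y := eps) (fun i j a b => eps_swap_right i j b a)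
    (fun i j a b => eps_swap_left j i a b)
  have h3 : bivMat (P.det • eps) = P.det • bivMat eps := rfl
  have h4 := congrArg Matrix.det h2
  rw [h1, h3, Matrix.det_smul, Matrix.det_mul, Matrix.det_mul, Matrix.det_transpose,
    det_bivMat_eps, Fintype.card_fin] at h4
  linear_combination h4

/-- The difference of the squared magnetic and electric parts of a bivector. -/
def minkowskiSq (B : BV) : ℝ :=
  B 2 3 ^ 2 + B 3 1 ^ 2 + B 1 2 ^ 2 - B 0 1 ^ 2 - B 0 2 ^ 2 - B 0 3 ^ 2

/-- The Pfaffian of a bivector. -/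
def pfaffian (B : BV) : ℝ := B 0 1 * B 2 3 + B 0 2 * B 3 1 + B 0 3 * B 1 2

lemma minkowski_eq : minkowski = !![-1,0,0,0; 0,1,0,0; 0,0,1,0; 0,0,0,1] := by
  ext i j
  fin_cases i <;> fin_cases j <;> rfl

lemma det_bivMat_qMedium_minkowski (c r t : ℝ) (hc : c ≠ 0) (B : Matrix (Fin 4) (Fin 4) ℝ) :
    (bivMat (qMedium c r t minkowski B)).det =
      - (c ^ 2 + t ^ 2) ^ 2 * (c ^ 2 + t ^ 2 + r * (c * minkowskiSq B + 2 * t * pfaffian B)) := by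
  let M : Matrix (Fin 6) (Fin 6) ℝ := !![-c,0,0,t,0,0; 0,-c,0,0,t,0; 0,0,-c,0,0,t;
    t,0,0,c,0,0; 0,t,0,0,c,0; 0,0,t,0,0,c]
  let b : Fin 6 → ℝ := fun K => B (pairs K).1 (pairs K).2
  have hct : c ^ 2 + t ^ 2 ≠ 0 := by positivity
  have h1 : bivMat (qMedium c r t minkowski B) =
      M + replicateCol Unit b * replicateRow Unit (r • b) := by
    ext I J
    have hb : (replicateCol Unit b * replicateRow Unit (r • b)) I J = r * (b I * b J) := by
      simp [Matrix.mul_apply]; ring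
    rw [Matrix.add_apply, hb]
    fin_cases I <;> fin_cases J <;>
      simp [M, b, bivMat, qMedium, pairs, eps, minkowski_eq] <;> ring
  have h2 : M * M = (c ^ 2 + t ^ 2) • (1 : Matrix (Fin 6) (Fin 6) ℝ) := by
    ext I J
    fin_cases I <;> fin_cases J <;> simp [M, Matrix.mul_apply, Fin.sum_univ_six] <;> ring
  have h3 : M.det = - (c ^ 2 + t ^ 2) ^ 3 := by
    simp [M, Matrix.det_succ_row_zero, Fin.sum_univ_succ, Fin.succAbove]
    ring
  have h4 : M⁻¹ = (c ^ 2 + t ^ 2)⁻¹ • M := by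
    apply Matrix.inv_eq_right_inv
    rw [Matrix.mul_smul, h2, smul_smul, inv_mul_cancel₀ hct, one_smul]
  have h5 : b ⬝ᵥ M *ᵥ b = c * minkowskiSq B + 2 * t * pfaffian B := by
    simp [dotProduct, Matrix.mulVec, Fin.sum_univ_six, M, b, pairs, minkowskiSq, pfaffian]
    ring
  have h6 : (1 + replicateRow Unit (r • b) * M⁻¹ * replicateCol Unit b).det =
      1 + r * (c ^ 2 + t ^ 2)⁻¹ * (b ⬝ᵥ M *ᵥ b) := by
    rw [h4, Matrix.mul_assoc, Matrix.smul_mul, Matrix.mul_smul, Matrix.det_unique]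
    rw [Matrix.add_apply, Matrix.smul_apply, ← Matrix.replicateCol_mulVec, Matrix.mul_apply]
    simp [dotProduct, Finset.mul_sum]
    exact Finset.sum_congr rfl fun _ _ => by ring
  rw [h1, Matrix.det_add_replicateCol_mul_replicateRow (by rw [h3]; simp [hct]), h6, h3, h5]
  field_simp

lemma det_minkowski : minkowski.det = -1 := by
  simp [minkowski, Matrix.det_diagonal, Fin.prod_univ_four]

lemma adjugate_minkowski : minkowski.adjugate = -minkowski := by
  have h : minkowski * minkowski = 1 := by
    rw [minkowski, Matrix.diagonal_mul_diagonal, ← Matrix.diagonal_one]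
    congr 1
    funext i
    fin_cases i <;> simp
  have h1 := congrArg (minkowski * ·) (Matrix.mul_adjugate minkowski)
  simpa [← Matrix.mul_assoc, h, det_minkowski] using h1

lemma qMedium_smul (c r t : ℝ) {σ : ℝ} (hσ : σ ^ 2 = 1) (q A : Matrix (Fin 4) (Fin 4) ℝ) :
    qMedium c r t (σ • q) A = qMedium c r t q A := by
  funext i j a b
  simp only [qMedium, Matrix.smul_apply, smul_eq_mul]
  linear_combination c * (q i a * q j b - q i b * q j a) * hσ

lemma secondFactor_smul (c r : ℝ) {σ : ℝ} (hσ : σ ^ 2 = 1) (q A : Matrix (Fin 4) (Fin 4) ℝ) :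
    secondFactor c r (σ • q) A = σ • secondFactor c r q A := by
  have h3 : σ ^ 3 = σ := by linear_combination σ * hσ
  have h4 : σ ^ 4 = 1 := by linear_combination (σ ^ 2 + 1) * hσ
  simp only [secondFactor, Matrix.det_smul, Matrix.adjugate_smul, Fintype.card_fin, h3, h4,
    Nat.add_one_sub_one, Matrix.mul_smul, Matrix.smul_mul, smul_add, smul_smul, one_mul]
  congr 2 <;> ring

lemma det_bivMat_qMedium (c r t : ℝ) (hc : c ≠ 0) (P : Matrix (Fin 4) (Fin 4) ℝ)
    {B : Matrix (Fin 4) (Fin 4) ℝ} (hB : antisymBV B) :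
    (bivMat (qMedium c r (P.det * t) (P * minkowski * Pᵀ) (P * B * Pᵀ))).det =
      - P.det ^ 6 * ((c ^ 2 + t ^ 2) ^ 2 *
        (c ^ 2 + t ^ 2 + r * (c * minkowskiSq B + 2 * t * pfaffian B))) := by
  rw [← pushMT_qMedium, bivMat_pushMT P (fun i j a b => qMedium_swap_right _ _ _ _ hB i j b a)
      (fun i j a b => qMedium_swap_left _ _ _ _ hB j i a b),
    Matrix.det_mul, Matrix.det_mul, Matrix.det_transpose,
    det_bivMat_qMedium_minkowski c r t hc, ← det_compound_sq]
  ring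

/-- The discriminant of the second quadratic factor in a Lorentz frame. -/
def frameDisc (c r : ℝ) (B : BV) : ℝ := c ^ 2 + r * c * minkowskiSq B - r ^ 2 * pfaffian B ^ 2

lemma secondFactor_minkowski (c r : ℝ) (B : Matrix (Fin 4) (Fin 4) ℝ) :
    secondFactor c r minkowski B = -(c • minkowski + r • (Bᵀ * minkowski * B)) := by
  simp only [secondFactor, det_minkowski, adjugate_minkowski, Matrix.neg_mul,
    smul_neg, mul_neg, mul_one, neg_smul, neg_add]

lemma det_secondFactor_minkowski (c r : ℝ) {B : Matrix (Fin 4) (Fin 4) ℝ} (hB : antisymBV B) :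
    (secondFactor c r minkowski B).det = - frameDisc c r B ^ 2 := by
  have hd : ∀ i, B i i = 0 := fun i => by linarith [hB i i]
  rw [secondFactor_minkowski, Matrix.det_neg, Fintype.card_fin, Matrix.det_succ_row_zero]
  simp [Fin.sum_univ_four, Matrix.det_fin_three, Fin.succAbove, Matrix.mul_apply, minkowski_eq,
    hd, hB 1 0, hB 2 0, hB 3 0, hB 2 1, hB 3 2, hB 1 3, frameDisc, minkowskiSq, pfaffian]
  ring

lemma eq_zero_of_secondFactor_minkowski {c r μ : ℝ} {B : Matrix (Fin 4) (Fin 4) ℝ}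
    (hB : antisymBV B) (h : secondFactor c r minkowski B = μ • minkowski) : r = 0 ∨ B = 0 := by
  have hd : ∀ i, B i i = 0 := fun i => by linarith [hB i i]
  rw [secondFactor_minkowski] at h
  have e : ∀ i, _ := fun i => congrFun (congrFun h i) i
  have e0 := e 0
  have e1 := e 1
  have e2 := e 2
  have e3 := e 3
  simp [Fin.sum_univ_four, Matrix.mul_apply, minkowski_eq,
    hd, hB 1 0, hB 2 0, hB 3 0, hB 2 1, hB 3 2, hB 1 3] at e0 e1 e2 e3
  rw [or_iff_not_imp_left]
  intro hr
  have hs : B 0 1 ^ 2 + B 0 2 ^ 2 + B 0 3 ^ 2 + B 2 3 ^ 2 + B 3 1 ^ 2 + B 1 2 ^ 2 = 0 := by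
    refine mul_left_cancel₀ hr ?_
    linear_combination (-3 * e0 - e1 - e2 - e3) / 2
  have p := fun i j => sq_nonneg (B i j)
  have z1 : B 0 1 = 0 := sq_eq_zero_iff.1 (by linarith [p 0 1, p 0 2, p 0 3, p 2 3, p 3 1, p 1 2])
  have z2 : B 0 2 = 0 := sq_eq_zero_iff.1 (by linarith [p 0 1, p 0 2, p 0 3, p 2 3, p 3 1, p 1 2])
  have z3 : B 0 3 = 0 := sq_eq_zero_iff.1 (by linarith [p 0 1, p 0 2, p 0 3, p 2 3, p 3 1, p 1 2])
  have z4 : B 2 3 = 0 := sq_eq_zero_iff.1 (by linarith [p 0 1, p 0 2, p 0 3, p 2 3, p 3 1, p 1 2])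
  have z5 : B 3 1 = 0 := sq_eq_zero_iff.1 (by linarith [p 0 1, p 0 2, p 0 3, p 2 3, p 3 1, p 1 2])
  have z6 : B 1 2 = 0 := sq_eq_zero_iff.1 (by linarith [p 0 1, p 0 2, p 0 3, p 2 3, p 3 1, p 1 2])
  ext i j
  fin_cases i <;> fin_cases j <;>
    simp [hd, hB 1 0, hB 2 0, hB 3 0, hB 2 1, hB 3 2, hB 1 3, z1, z2, z3, z4, z5, z6]

/-- A rational parametrization of the Minkowski light cone. -/
def conePoint {R : Type*} [CommRing R] (u v : R) : Fin 4 → R :=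
  ![1 + u ^ 2 + v ^ 2, 2 * u, 2 * v, 1 - u ^ 2 - v ^ 2]

lemma conePoint_null (u v : ℝ) : conePoint u v ⬝ᵥ minkowski *ᵥ conePoint u v = 0 := by
  simp only [conePoint, minkowski_eq, Matrix.mulVec, dotProduct, Fin.sum_univ_four,
    Matrix.of_apply, Matrix.cons_val]
  ring

lemma eq_smul_minkowski {Q : Matrix (Fin 4) (Fin 4) ℝ} (hQ : Q.IsSymm)
    (h : ∀ u v : ℝ, conePoint u v ⬝ᵥ Q *ᵥ conePoint u v = 0) : ∃ μ : ℝ, Q = μ • minkowski := by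
  have s := fun i j => hQ.apply i j
  simp only [conePoint, Matrix.mulVec, dotProduct, Fin.sum_univ_four, Matrix.cons_val,
    s 0 1, s 0 2, s 0 3, s 1 2, s 1 3, s 2 3] at h
  have h1 := h 1 0
  have h2 := h (-1) 0
  have h3 := h 0 1
  have h4 := h 0 (-1)
  have h5 := h 0 0
  have h6 := h 2 0
  have h7 := h (-2) 0
  have h8 := h 0 2
  have h9 := h 0 (-2)
  have h10 := h 1 1
  have q01 : Q 0 1 = 0 := by linarith
  have q02 : Q 0 2 = 0 := by linarith
  have q11 : Q 1 1 = -Q 0 0 := by linarith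
  have q22 : Q 2 2 = -Q 0 0 := by linarith
  have q03 : Q 0 3 = 0 := by linarith
  have q33 : Q 3 3 = -Q 0 0 := by linarith
  have q13 : Q 1 3 = 0 := by linarith
  have q23 : Q 2 3 = 0 := by linarith
  have q12 : Q 1 2 = 0 := by linarith
  refine ⟨-Q 0 0, ?_⟩
  ext i j
  fin_cases i <;> fin_cases j <;>
    simp [minkowski_eq, s 0 1, s 0 2, s 0 3, s 1 2, s 1 3, s 2 3, q01, q02, q03, q11, q12, q13,
      q22, q23, q33]

lemma eq_smul_minkowski_or {Q₁ Q₂ : Matrix (Fin 4) (Fin 4) ℝ} (h₁ : Q₁.IsSymm) (h₂ : Q₂.IsSymm)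
    (h : ∀ ξ : Fin 4 → ℝ, ξ ⬝ᵥ minkowski *ᵥ ξ = 0 → (ξ ⬝ᵥ Q₁ *ᵥ ξ) * (ξ ⬝ᵥ Q₂ *ᵥ ξ) = 0) :
    (∃ μ : ℝ, Q₁ = μ • minkowski) ∨ ∃ μ : ℝ, Q₂ = μ • minkowski := by
  let p (Q : Matrix (Fin 4) (Fin 4) ℝ) : MvPolynomial (Fin 2) ℝ :=
    conePoint (.X 0) (.X 1) ⬝ᵥ Q.map MvPolynomial.C *ᵥ conePoint (.X 0) (.X 1)
  have hp : ∀ Q x, MvPolynomial.eval x (p Q) =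
      conePoint (x 0) (x 1) ⬝ᵥ Q *ᵥ conePoint (x 0) (x 1) := by
    intro Q x
    simp [p, Matrix.mulVec, dotProduct, Fin.sum_univ_four, conePoint]
  have hz : ∀ Q, p Q = 0 → ∀ u v : ℝ, conePoint u v ⬝ᵥ Q *ᵥ conePoint u v = 0 := by
    intro Q hQ u v
    simpa [hQ] using (hp Q ![u, v]).symm
  have h0 : p Q₁ * p Q₂ = 0 := MvPolynomial.funext fun x => by
    rw [map_mul, hp, hp, h _ (conePoint_null _ _), map_zero]
  exact (mul_eq_zero.1 h0).imp (fun h => eq_smul_minkowski h₁ (hz _ h))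
    fun h => eq_smul_minkowski h₂ (hz _ h)

lemma mem_nullCone {g : Matrix (Fin 4) (Fin 4) ℝ} {ξ : Fin 4 → ℝ} :
    ξ ∈ nullCone g ↔ ξ ⬝ᵥ g⁻¹ *ᵥ ξ = 0 := by
  have h : ∑ i, ∑ j, g⁻¹ i j * ξ i * ξ j = ξ ⬝ᵥ g⁻¹ *ᵥ ξ := by
    simp only [dotProduct, Matrix.mulVec, Finset.mul_sum]
    exact Finset.sum_congr rfl fun i _ => Finset.sum_congr rfl fun j _ => by ring
  rw [nullCone, Set.mem_ofPred_eq, h]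

lemma dotProduct_conj_mulVec (P Q : Matrix (Fin 4) (Fin 4) ℝ) (ξ : Fin 4 → ℝ) :
    ξ ⬝ᵥ (P * Q * Pᵀ) *ᵥ ξ = (ξ ᵥ* P) ⬝ᵥ Q *ᵥ (ξ ᵥ* P) := by
  rw [← Matrix.mulVec_mulVec, ← Matrix.mulVec_mulVec, Matrix.mulVec_transpose,
    Matrix.dotProduct_mulVec ξ P]

lemma conj_inv_eq {P : Matrix (Fin 4) (Fin 4) ℝ} (hP : P.det ≠ 0)
    (Q : Matrix (Fin 4) (Fin 4) ℝ) : P * (P⁻¹ * Q * P⁻¹ᵀ) * Pᵀ = Q := by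
  have h1 : P * P⁻¹ = 1 := Matrix.mul_nonsing_inv P (isUnit_iff_ne_zero.2 hP)
  have h2 : P⁻¹ᵀ * Pᵀ = 1 := by rw [← Matrix.transpose_mul, h1, Matrix.transpose_one]
  calc P * (P⁻¹ * Q * P⁻¹ᵀ) * Pᵀ = (P * P⁻¹) * Q * (P⁻¹ᵀ * Pᵀ) := by
        simp only [Matrix.mul_assoc]
    _ = Q := by rw [h1, h2, Matrix.one_mul, Matrix.mul_one]

lemma mul_mul_transpose_inj {P : Matrix (Fin 4) (Fin 4) ℝ} (hP : P.det ≠ 0)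
    {Q R : Matrix (Fin 4) (Fin 4) ℝ} (h : P * Q * Pᵀ = P * R * Pᵀ) : Q = R := by
  have hu : IsUnit P := (Matrix.isUnit_iff_isUnit_det P).2 (isUnit_iff_ne_zero.2 hP)
  have hu' : IsUnit Pᵀ := (Matrix.isUnit_transpose P).2 hu
  exact hu.mul_left_cancel (hu'.mul_right_cancel h)

/-- A product of two quadratic forms vanishes on the null cone of a Lorentz metric only if one of
the factors is proportional to the metric. -/
lemma IsLorentz.eq_smul_inv_or {g : Matrix (Fin 4) (Fin 4) ℝ} (hg : IsLorentz g)
    {Q₁ Q₂ : Matrix (Fin 4) (Fin 4) ℝ} (h₁ : Q₁.IsSymm) (h₂ : Q₂.IsSymm)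
    (h : ∀ ξ ∈ nullCone g, (ξ ⬝ᵥ Q₁ *ᵥ ξ) * (ξ ⬝ᵥ Q₂ *ᵥ ξ) = 0) :
    (∃ μ : ℝ, Q₁ = μ • g⁻¹) ∨ ∃ μ : ℝ, Q₂ = μ • g⁻¹ := by
  obtain ⟨σ, P, hσ, hP, hgP⟩ := exists_frame hg
  have hσ0 : σ ≠ 0 := by rintro rfl; norm_num at hσ
  have hs : ∀ Q : Matrix (Fin 4) (Fin 4) ℝ, Q.IsSymm → (P⁻¹ * Q * P⁻¹ᵀ).IsSymm := by
    intro Q hQ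
    simp only [Matrix.IsSymm, Matrix.transpose_mul, Matrix.transpose_transpose, hQ.eq,
      Matrix.mul_assoc]
  have hback : ∀ Q : Matrix (Fin 4) (Fin 4) ℝ, (∃ μ : ℝ, P⁻¹ * Q * P⁻¹ᵀ = μ • minkowski) →
      ∃ μ : ℝ, Q = μ • g⁻¹ := by
    rintro Q ⟨μ, hμ⟩
    refine ⟨μ * σ, ?_⟩
    rw [← conj_inv_eq hP Q, hμ, hgP, smul_smul, Matrix.mul_smul, Matrix.smul_mul]
    congr 1
    linear_combination (-μ) * hσ
  refine (eq_smul_minkowski_or (hs _ h₁) (hs _ h₂) fun ζ hζ => ?_).imp (hback Q₁) (hback Q₂)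
  have hζ' : (ζ ᵥ* P⁻¹) ᵥ* P = ζ := by
    rw [Matrix.vecMul_vecMul, Matrix.nonsing_inv_mul P (isUnit_iff_ne_zero.2 hP),
      Matrix.vecMul_one]
  have h3 : ζ ᵥ* P⁻¹ ∈ nullCone g := by
    rw [mem_nullCone, hgP, Matrix.smul_mulVec, dotProduct_smul, dotProduct_conj_mulVec, hζ', hζ,
      smul_zero]
  have h4 : ∀ Q, ζ ᵥ* P⁻¹ ⬝ᵥ Q *ᵥ (ζ ᵥ* P⁻¹) = ζ ⬝ᵥ (P⁻¹ * Q * P⁻¹ᵀ) *ᵥ ζ := fun Q =>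
    (dotProduct_conj_mulVec _ _ _).symm
  rw [← h4, ← h4, h _ h3]

lemma traceT_tensAB_conj (ρ : ℝ) (P : Matrix (Fin 4) (Fin 4) ℝ) {B : Matrix (Fin 4) (Fin 4) ℝ}
    (hB : antisymBV B) :
    traceT (tensAB ρ (P * B * Pᵀ) (P * B * Pᵀ)) = 4 * ρ * P.det * pfaffian B := by
  have h1 : ∀ A : BV, traceT (tensAB ρ A A) =
      ρ / 2 * ∑ i, ∑ j, ∑ a, ∑ b, eps i j a b * (A i j * A a b) := by
    intro A
    simp only [traceT, tensAB, Finset.mul_sum, Finset.sum_mul]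
    exact Finset.sum_congr rfl fun i _ => Finset.sum_congr rfl fun j _ =>
      Finset.sum_congr rfl fun a _ => Finset.sum_congr rfl fun b _ => by ring
  have h2 : ∀ i j a b, (P * B * Pᵀ) i j * (P * B * Pᵀ) a b =
      ∑ e, ∑ f, ∑ g, ∑ h, P i e * P j f * P a g * P b h * (B e f * B g h) := by
    intro i j a b
    simp only [Matrix.mul_apply, Matrix.transpose_apply, Fin.sum_univ_four]
    ring
  have h3 : ∑ i, ∑ j, ∑ a, ∑ b, eps i j a b * (B i j * B a b) = 8 * pfaffian B := by
    simp [Fin.sum_univ_four, eps, pfaffian, hB 1 0, hB 2 0, hB 3 0, hB 2 1, hB 3 2, hB 1 3]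
    ring
  refine (h1 _).trans ?_
  simp only [h2]
  rw [sum_eps_mul_sum_columns P fun e f g h => B e f * B g h, h3]
  ring

lemma secondFactor_isSymm (c r : ℝ) {q A : Matrix (Fin 4) (Fin 4) ℝ} (hq : q.IsSymm) :
    (secondFactor c r q A).IsSymm := by
  simp only [secondFactor, Matrix.IsSymm, Matrix.transpose_add, Matrix.transpose_smul,
    Matrix.transpose_mul, Matrix.transpose_transpose, Matrix.adjugate_transpose, hq.eq,
    Matrix.mul_assoc]

lemma inv_isSymm {g : Matrix (Fin 4) (Fin 4) ℝ} (hg : g.IsSymm) : g⁻¹.IsSymm := by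
  rw [Matrix.IsSymm, Matrix.transpose_nonsing_inv, hg.eq]

lemma exists_bivector_frame {P : Matrix (Fin 4) (Fin 4) ℝ} (hP : P.det ≠ 0)
    {A : Matrix (Fin 4) (Fin 4) ℝ} (hA : antisymBV A) :
    ∃ B : Matrix (Fin 4) (Fin 4) ℝ, antisymBV B ∧ A = P * B * Pᵀ := by
  refine ⟨P⁻¹ * A * P⁻¹ᵀ, fun i j => ?_, (conj_inv_eq hP A).symm⟩
  have h : Aᵀ = -A := by ext i j; exact hA j i
  have h' : (P⁻¹ * A * P⁻¹ᵀ)ᵀ = -(P⁻¹ * A * P⁻¹ᵀ) := by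
    simp only [Matrix.transpose_mul, Matrix.transpose_transpose, h, Matrix.mul_assoc,
      Matrix.neg_mul, Matrix.mul_neg]
  exact congrFun (congrFun h' j) i

lemma det_secondFactor_frame (c r : ℝ) {σ : ℝ} (hσ : σ ^ 2 = 1) (P : Matrix (Fin 4) (Fin 4) ℝ)
    {B : Matrix (Fin 4) (Fin 4) ℝ} (hB : antisymBV B) :
    (secondFactor c r (σ • (P * minkowski * Pᵀ)) (P * B * Pᵀ)).det =
      -(P.det ^ 5 * frameDisc c r B) ^ 2 := by
  have h4 : σ ^ 4 = 1 := by linear_combination (σ ^ 2 + 1) * hσ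
  rw [secondFactor_smul c r hσ, secondFactor_conj, Matrix.det_smul, Matrix.det_smul,
    Matrix.det_mul, Matrix.det_mul, Matrix.det_transpose, det_secondFactor_minkowski c r hB,
    Fintype.card_fin, h4]
  ring

lemma eq_zero_of_secondFactor_eq_smul {g A : Matrix (Fin 4) (Fin 4) ℝ} (hg : IsLorentz g)
    (hA : antisymBV A) {c r μ : ℝ} (h : secondFactor c r g⁻¹ A = μ • g⁻¹) : r = 0 ∨ A = 0 := by
  obtain ⟨σ, P, hσ, hP, hgP⟩ := exists_frame hg
  obtain ⟨B, hB, rfl⟩ := exists_bivector_frame hP hA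
  have hσ0 : σ ≠ 0 := by rintro rfl; norm_num at hσ
  rw [hgP, secondFactor_smul c r hσ, secondFactor_conj, smul_comm μ σ] at h
  have h1 : P.det ^ 2 • (P * secondFactor c r minkowski B * Pᵀ) = μ • (P * minkowski * Pᵀ) :=
    smul_right_injective _ hσ0 h
  have h2 : P * secondFactor c r minkowski B * Pᵀ =
      P * ((μ / P.det ^ 2) • minkowski) * Pᵀ := by
    rw [Matrix.mul_smul, Matrix.smul_mul, div_eq_inv_mul, ← smul_smul, ← h1,
      inv_smul_smul₀ (pow_ne_zero 2 hP)]
  refine (eq_zero_of_secondFactor_minkowski hB (mul_mul_transpose_inj hP h2)).imp_right ?_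
  rintro rfl
  simp

/-- The generalized Q-medium `C₁ ∗_g + ρ Ā⊗A + C₂ Id`. -/
def generalizedQMedium (g : Matrix (Fin 4) (Fin 4) ℝ) (A : BV) (C₁ C₂ ρ : ℝ) : MT :=
  fun i j r s => C₁ * hodge g i j r s + tensAB ρ A A i j r s + C₂ * idT i j r s

lemma generalizedQMedium_eq (g A : Matrix (Fin 4) (Fin 4) ℝ) (C₁ C₂ ρ : ℝ) :
    generalizedQMedium g A C₁ C₂ ρ =
      lowerMT (qMedium (C₁ * √|g.det|) (2 * ρ) C₂ g⁻¹ A) :=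
  (lowerMT_qMedium g A C₁ C₂ ρ).symm

/-- The second metric factor of the Fresnel polynomial of a generalized Q-medium. -/
def secondMetric (g A : Matrix (Fin 4) (Fin 4) ℝ) (C₁ ρ : ℝ) : Matrix (Fin 4) (Fin 4) ℝ :=
  secondFactor (C₁ * √|g.det|) (2 * ρ) g⁻¹ A

lemma det_mat6_generalizedQMedium_eq_iff {g A : Matrix (Fin 4) (Fin 4) ℝ} (hg : IsLorentz g)
    (hA : antisymBV A) {C₁ : ℝ} (hC₁ : C₁ ≠ 0) (C₂ ρ : ℝ) :
    (mat6 (generalizedQMedium g A C₁ C₂ ρ)).det =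
        (C₁ ^ 2 + C₂ ^ 2) ^ 2 * (C₂ + (1 / 2) * traceT (tensAB ρ A A)) ^ 2 ↔
      (secondMetric g A C₁ ρ).det = 0 := by
  obtain ⟨σ, P, hσ, hP, hgP⟩ := exists_frame hg
  obtain ⟨B, hB, rfl⟩ := exists_bivector_frame hP hA
  have h4 : σ ^ 4 = 1 := by linear_combination (σ ^ 2 + 1) * hσ
  have hgd : g.det * -P.det ^ 2 = 1 := by
    have h := congrArg Matrix.det (Matrix.mul_nonsing_inv g (isUnit_iff_ne_zero.2 hg.2.ne))
    rw [Matrix.det_mul, hgP, Matrix.det_smul, Matrix.det_mul, Matrix.det_mul,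
      Matrix.det_transpose, det_minkowski, Matrix.det_one, Fintype.card_fin, h4] at h
    linear_combination h
  have hs : √|g.det| ^ 2 * P.det ^ 2 = 1 := by
    rw [Real.sq_sqrt (abs_nonneg _), abs_of_neg hg.2]
    linear_combination hgd
  rw [secondMetric, hgP, det_secondFactor_frame _ _ hσ P hB, generalizedQMedium_eq,
    hgP, qMedium_smul _ _ _ hσ,
    mat6_lowerMT (fun i j a b => qMedium_swap_right _ _ _ _ hA i j b a), Matrix.det_transpose,
    Matrix.det_mul, det_bivMat_eps, traceT_tensAB_conj ρ P hB]
  set s := √|g.det|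
  have hs0 : s ≠ 0 := by rintro h; simp [h] at hs
  have hc : C₁ * s ≠ 0 := mul_ne_zero hC₁ hs0
  obtain ⟨t, rfl⟩ : ∃ t, C₂ = P.det * t := ⟨C₂ / P.det, by field_simp⟩
  rw [det_bivMat_qMedium _ _ _ hc P hB]
  have hC : C₁ ^ 2 = (C₁ * s) ^ 2 * P.det ^ 2 := by linear_combination (-C₁ ^ 2) * hs
  rw [hC, ← sub_eq_zero]
  generalize C₁ * s = c at hc
  have hct : c ^ 2 + t ^ 2 ≠ 0 := by positivity
  have key : -P.det ^ 6 * ((c ^ 2 + t ^ 2) ^ 2 *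
        (c ^ 2 + t ^ 2 + 2 * ρ * (c * minkowskiSq B + 2 * t * pfaffian B))) * -1 -
      (c ^ 2 * P.det ^ 2 + (P.det * t) ^ 2) ^ 2 *
        (P.det * t + 1 / 2 * (4 * ρ * P.det * pfaffian B)) ^ 2 =
      P.det ^ 6 * (c ^ 2 + t ^ 2) ^ 2 * frameDisc c (2 * ρ) B := by
    unfold frameDisc; ring
  rw [key]
  simp [hP, hct]

lemma det_secondMetric_nonpos {g A : Matrix (Fin 4) (Fin 4) ℝ} (hg : IsLorentz g)
    (hA : antisymBV A) (C₁ ρ : ℝ) : (secondMetric g A C₁ ρ).det ≤ 0 := by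
  obtain ⟨σ, P, hσ, hP, hgP⟩ := exists_frame hg
  obtain ⟨B, hB, rfl⟩ := exists_bivector_frame hP hA
  rw [secondMetric, hgP, det_secondFactor_frame _ _ hσ P hB]
  exact neg_nonpos.2 (sq_nonneg _)

lemma secondMetric_isSymm {g : Matrix (Fin 4) (Fin 4) ℝ} (hg : IsLorentz g)
    (A : Matrix (Fin 4) (Fin 4) ℝ) (C₁ ρ : ℝ) : (secondMetric g A C₁ ρ).IsSymm :=
  secondFactor_isSymm _ _ (inv_isSymm hg.1)

lemma exists_secondMetric_eq_smul {g A : Matrix (Fin 4) (Fin 4) ℝ} (hg : IsLorentz g)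
    {C₁ ρ : ℝ} (hC₁ : C₁ ≠ 0) (h : ρ = 0 ∨ A = 0) :
    ∃ μ : ℝ, μ ≠ 0 ∧ secondMetric g A C₁ ρ = μ • g⁻¹ := by
  refine ⟨C₁ * √|g.det| * g⁻¹.det, ?_, ?_⟩
  · have hs : √|g.det| ≠ 0 := (Real.sqrt_pos.2 (abs_pos.2 hg.2.ne)).ne'
    have hd := Matrix.isUnit_nonsing_inv_det g (isUnit_iff_ne_zero.2 hg.2.ne)
    exact mul_ne_zero (mul_ne_zero hC₁ hs) hd.ne_zero
  · rcases h with rfl | rfl <;> simp [secondMetric, secondFactor]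

lemma fresnel_generalizedQMedium_eq_zero_iff {g A : Matrix (Fin 4) (Fin 4) ℝ} (hg : IsLorentz g)
    (hA : antisymBV A) {C₁ : ℝ} (hC₁ : C₁ ≠ 0) (C₂ ρ : ℝ) (ξ : Fin 4 → ℝ) :
    fresnel (generalizedQMedium g A C₁ C₂ ρ) ξ = 0 ↔
      (ξ ⬝ᵥ g⁻¹ *ᵥ ξ) * (ξ ⬝ᵥ secondMetric g A C₁ ρ *ᵥ ξ) = 0 := by
  have hs : √|g.det| ≠ 0 := (Real.sqrt_pos.2 (abs_pos.2 hg.2.ne)).ne'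
  rw [generalizedQMedium_eq,
    fresnel_lowerMT (qMedium_swap_right _ _ _ _ hA),
    fresnelForm_qMedium _ _ _ (inv_isSymm hg.1) hA, ← secondMetric]
  simp [hC₁, hs]

lemma IsLorentz.inv_ne_zero {g : Matrix (Fin 4) (Fin 4) ℝ} (hg : IsLorentz g) : g⁻¹ ≠ 0 := by
  intro h
  have h1 := Matrix.mul_nonsing_inv g (isUnit_iff_ne_zero.2 hg.2.ne)
  rw [h, Matrix.mul_zero] at h1
  exact zero_ne_one h1

lemma IsLorentz.nullCone_eq {g G : Matrix (Fin 4) (Fin 4) ℝ} (hg : IsLorentz g) {μ : ℝ}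
    (h : g⁻¹ = μ • G⁻¹) : nullCone g = nullCone G := by
  have hμ : μ ≠ 0 := by
    rintro rfl
    exact hg.inv_ne_zero (by rw [h, zero_smul])
  ext ξ
  simp [mem_nullCone, h, Matrix.smul_mulVec, hμ]

lemma exists_eq_smul_inv_of_nullCone_eq {g G : Matrix (Fin 4) (Fin 4) ℝ} (hg : IsLorentz g)
    (hG : G.IsSymm) (h : nullCone g = nullCone G) : ∃ μ : ℝ, G⁻¹ = μ • g⁻¹ := by
  refine or_self_iff.1 (hg.eq_smul_inv_or (inv_isSymm hG) (inv_isSymm hG) fun ξ hξ => ?_)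
  rw [mem_nullCone.1 (h ▸ hξ), zero_mul]

lemma IsLorentz.det_smul_inv_ne_zero {g : Matrix (Fin 4) (Fin 4) ℝ} (hg : IsLorentz g) {μ : ℝ}
    (hμ : μ ≠ 0) : (μ • g⁻¹).det ≠ 0 := by
  have h := Matrix.isUnit_nonsing_inv_det g (isUnit_iff_ne_zero.2 hg.2.ne)
  rw [Matrix.det_smul]
  exact mul_ne_zero (pow_ne_zero _ hμ) h.ne_zero

/-- The generalized Q-medium κ = C₁·∗_g + ρ(Ā⊗A) + C₂·Id has a double light
cone if and only if ρ ≠ 0, A ≠ 0 and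
det κ ≠ (C₁² + C₂²)²·(C₂ + (1/2)·tr(ρ Ā⊗A))². -/
theorem stmt13 (g : Matrix (Fin 4) (Fin 4) ℝ) (hg : IsLorentz g)
    (C₁ C₂ ρ : ℝ) (hC₁ : C₁ ≠ 0) (A : BV) (hA : antisymBV A) :
    DoubleCone (fun i j r s =>
        C₁ * hodge g i j r s + tensAB ρ A A i j r s + C₂ * idT i j r s) ↔
      (ρ ≠ 0 ∧ A ≠ 0 ∧
        (mat6 (fun i j r s =>
          C₁ * hodge g i j r s + tensAB ρ A A i j r s + C₂ * idT i j r s)).det ≠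
            (C₁ ^ 2 + C₂ ^ 2) ^ 2 * (C₂ + (1 / 2) * traceT (tensAB ρ A A)) ^ 2) := by
  change DoubleCone (generalizedQMedium g A C₁ C₂ ρ) ↔ ρ ≠ 0 ∧ A ≠ 0 ∧
    (mat6 (generalizedQMedium g A C₁ C₂ ρ)).det ≠ _
  rw [Ne, Ne, Ne, det_mat6_generalizedQMedium_eq_iff hg hA hC₁, ← and_assoc, ← not_or]
  have hzero := fresnel_generalizedQMedium_eq_zero_iff hg hA hC₁ C₂ ρ
  have hsymm := secondMetric_isSymm hg A C₁ ρ
  have hnonpos := det_secondMetric_nonpos hg hA C₁ ρ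
  have hsmul : ∀ μ : ℝ, secondMetric g A C₁ ρ = μ • g⁻¹ → ρ = 0 ∨ A = 0 := fun μ h =>
    (eq_zero_of_secondFactor_eq_smul hg hA h).imp_left fun h => by simpa using h
  constructor
  · rintro ⟨gp, gm, hgp, hgm, hne, hset⟩
    have hdich : ∀ G, IsLorentz G → nullCone G ⊆ nullCone gp ∪ nullCone gm →
        nullCone g = nullCone G ∨ ∃ μ : ℝ, secondMetric g A C₁ ρ = μ • G⁻¹ := by
      intro G hG hsub
      refine (hG.eq_smul_inv_or (inv_isSymm hg.1) hsymm fun ξ hξ => ?_).imp_left ?_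
      · rw [← hzero]
        exact hset.symm.subset (hsub hξ)
      · rintro ⟨μ, h⟩
        exact hg.nullCone_eq h
    have hkey : ¬ ∀ G, IsLorentz G → ∀ μ : ℝ, secondMetric g A C₁ ρ = μ • G⁻¹ →
        nullCone g = nullCone G := by
      intro h
      have hall : ∀ G, IsLorentz G → nullCone G ⊆ nullCone gp ∪ nullCone gm →
          nullCone g = nullCone G := fun G hG hsub =>
        (hdich G hG hsub).elim id fun ⟨μ, hμ⟩ => h G hG μ hμ
      exact hne ((hall gp hgp Set.subset_union_left).symm.trans
        (hall gm hgm Set.subset_union_right))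
    have hnd : ¬ (ρ = 0 ∨ A = 0) := by
      intro h
      obtain ⟨μ, hμ, hH⟩ := exists_secondMetric_eq_smul (A := A) hg hC₁ h
      refine hkey fun G _ ν hν => hg.nullCone_eq (μ := μ⁻¹ * ν) ?_
      rw [mul_smul, ← hν, hH, inv_smul_smul₀ hμ]
    refine ⟨hnd, fun hdet => hkey fun G hG μ hμ => ?_⟩
    rcases eq_or_ne μ 0 with rfl | h0
    · exact absurd (hsmul 0 (by rw [hμ, zero_smul, zero_smul])) hnd
    · exact absurd (hμ ▸ hdet) (hG.det_smul_inv_ne_zero h0)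
  · rintro ⟨hnd, hdet⟩
    have hu : IsUnit (secondMetric g A C₁ ρ).det := isUnit_iff_ne_zero.2 hdet
    have hinv := Matrix.nonsing_inv_nonsing_inv _ hu
    have hL : IsLorentz (secondMetric g A C₁ ρ)⁻¹ := by
      refine ⟨inv_isSymm hsymm, ?_⟩
      rw [Matrix.det_nonsing_inv, Ring.inverse_eq_inv']
      exact inv_lt_zero.2 (lt_of_le_of_ne hnonpos hdet)
    refine ⟨g, (secondMetric g A C₁ ρ)⁻¹, hg, hL, fun h => ?_, ?_⟩
    · obtain ⟨μ, hμ⟩ := exists_eq_smul_inv_of_nullCone_eq hg hL.1 h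
      exact hnd (hsmul μ (hinv ▸ hμ))
    · ext ξ
      rw [Set.mem_union, mem_nullCone, mem_nullCone, hinv, ← mul_eq_zero, ← hzero]
      rfl
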